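/- arXiv:2412.03828 — 2 statements merged into one kernel-verified Lean document; each statement's English description precedes it below -/
import Mathlib

section
/- For every d ≥ 1 and every c ∈ ℝ (in particular c = m² with m ≥ 0), the operator □ + c with domain C_c^∞(ℝ^{1+d}, ℂ) in L²(ℝ^{1+d}) is essentially self-adjoint: its closure is self-adjoint; equivalently, the ranges {(□ + c + i)φ : φ ∈ C_c^∞} and {(□ + c − i)φ : φ ∈ C_c^∞} are both dense in L²(ℝ^{1+d}). (This is the exact-Minkowski instance of the paper's main essential self-adjointness theorem.) -/
open MeasureTheory Complex

abbrev Spacetime (d : ℕ) := EuclideanSpace ℝ (Fin (d + 1))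

/-- The d'Alembertian `□f = ∂_t² f − Σ_{j=1}^d ∂_{x_j}² f` acting on plain functions
`ℝ^{1+d} → ℂ` (coordinate `0` is time). -/
noncomputable def boxFun (d : ℕ) (f : Spacetime d → ℂ) (z : Spacetime d) : ℂ :=
  fderiv ℝ (fun w => fderiv ℝ f w (EuclideanSpace.single 0 1)) z (EuclideanSpace.single 0 1)
    - ∑ j : Fin d,
      fderiv ℝ (fun w => fderiv ℝ f w (EuclideanSpace.single j.succ 1)) z
        (EuclideanSpace.single j.succ 1)

open SchwartzMap LineDeriv FourierTransform in
/-- Linear decay-type bound for derivatives of `χ - 1`. -/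
lemma cutoff_bound {E : Type*} [NormedAddCommGroup E] [InnerProductSpace ℝ E]
    [FiniteDimensional ℝ E] (χ : ContDiffBump (0 : E)) (i : ℕ) :
    ∃ C : ℝ, 0 ≤ C ∧ ∀ s : ℝ, 0 < s → s ≤ 1 → ∀ x : E,
      ‖iteratedFDeriv ℝ i (fun x => χ (s • x) - 1) x‖ ≤ C * s * ‖x‖ := by
  have hχ : ∀ n : ℕ∞, ContDiff ℝ n (χ : E → ℝ) := fun n => χ.contDiff
  have hg : ∀ n : ℕ∞, ContDiff ℝ n (fun x => χ x - 1) := fun n => (hχ n).sub contDiff_const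
  have hb : ∃ C : ℝ, ∀ y, ‖iteratedFDeriv ℝ i (fun x => χ x - 1) y‖ ≤ C := by
    obtain ⟨C, hC⟩ := (χ.hasCompactSupport.iteratedFDeriv (𝕜 := ℝ) i).exists_bound_of_continuous
      ((hχ i).continuous_iteratedFDeriv le_rfl)
    refine ⟨C + 1, fun y => ?_⟩
    have h1 : iteratedFDeriv ℝ i (fun x => χ x - 1) y
        = iteratedFDeriv ℝ i χ y - iteratedFDeriv ℝ i (fun _ : E => (1 : ℝ)) y :=
      fun_iteratedFDeriv_sub_apply ((hχ i).contDiffAt) contDiff_const.contDiffAt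
    rw [h1]
    refine (norm_sub_le _ _).trans (add_le_add (hC y) ?_)
    rcases Nat.eq_zero_or_pos i with rfl | hi
    · simp
    · rw [iteratedFDeriv_const_of_ne hi.ne']; simp
  obtain ⟨C, hC⟩ := hb
  have hC0 : 0 ≤ C := (norm_nonneg _).trans (hC 0)
  have hr := χ.rIn_pos
  have key : ∀ y, ‖iteratedFDeriv ℝ i (fun x => χ x - 1) y‖ ≤ C / χ.rIn * ‖y‖ := by
    intro y
    by_cases hy : ‖y‖ < χ.rIn
    · have h0 : (fun x => χ x - 1) =ᶠ[nhds y] fun _ => 0 := by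
        filter_upwards [χ.eventuallyEq_one_of_mem_ball (by simpa using hy)] with x hx
        simp [hx]
      rw [(h0.iteratedFDeriv ℝ i).eq_of_nhds]
      have : iteratedFDeriv ℝ i (fun _ : E => (0 : ℝ)) y = 0 := by
        simp [iteratedFDeriv_fun_zero]
      rw [this, norm_zero]; positivity
    · push Not at hy
      refine (hC y).trans ?_
      rw [div_mul_eq_mul_div, le_div_iff₀ hr]
      gcongr
  refine ⟨C / χ.rIn, by positivity, fun s hs hs1 x => ?_⟩
  have h2 := congrFun (iteratedFDeriv_comp_const_smul s (hg i)) x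
  rw [h2, norm_smul, norm_pow, Real.norm_of_nonneg hs.le]
  calc s ^ i * ‖iteratedFDeriv ℝ i (fun x => χ x - 1) (s • x)‖
      ≤ 1 * (C / χ.rIn * ‖s • x‖) := by
        gcongr
        · exact pow_le_one₀ hs.le hs1
        · exact key _
    _ = C / χ.rIn * s * ‖x‖ := by
        rw [norm_smul, Real.norm_of_nonneg hs.le]; ring

open SchwartzMap LineDeriv FourierTransform in
/-- Compactly supported smooth functions are dense in Schwartz space. -/
lemma dense_compactSupport {E F : Type*} [NormedAddCommGroup E] [InnerProductSpace ℝ E]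
    [FiniteDimensional ℝ E] [NormedAddCommGroup F] [NormedSpace ℝ F] :
    Dense {f : SchwartzMap E F | HasCompactSupport f} := by
  intro f
  let χ : ContDiffBump (0 : E) := default
  let s : ℕ → ℝ := fun n => 1 / ((n : ℝ) + 1)
  have hs : ∀ n, 0 < s n := fun n => by positivity
  have hs1 : ∀ n, s n ≤ 1 := fun n => by
    have : (0 : ℝ) ≤ n := by positivity
    simp only [s]
    rw [div_le_one (by positivity)]; linarith
  have hst : Filter.Tendsto s Filter.atTop (nhds 0) := tendsto_one_div_add_atTop_nhds_zero_nat
  have hsm : ∀ n (k : ℕ∞), ContDiff ℝ k (fun x : E => χ (s n • x)) := fun n k =>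
    χ.contDiff.comp (contDiff_const_smul (s n))
  have hcs : ∀ n, HasCompactSupport (fun x : E => χ (s n • x)) := fun n =>
    χ.hasCompactSupport.comp_smul (hs n).ne'
  let u : ℕ → SchwartzMap E F := fun n =>
    HasCompactSupport.toSchwartzMap (f := fun x => χ (s n • x) • f x) ((hcs n).smul_right)
      ((hsm n ⊤).smul (f.smooth ⊤))
  refine mem_closure_of_tendsto (f := u) (b := Filter.atTop) ?_
    (Filter.Eventually.of_forall fun n => (hcs n).smul_right)
  rw [(schwartz_withSeminorms ℝ E F).tendsto_nhds]
  rintro ⟨k, l⟩ ε hε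
  choose C hC0 hC using cutoff_bound χ
  let M : ℝ := ∑ i ∈ Finset.range (l + 1),
    (l.choose i : ℝ) * C i * SchwartzMap.seminorm ℝ (k + 1) (l - i) f
  have hM : 0 ≤ M := Finset.sum_nonneg fun i _ => by
    have := hC0 i
    positivity
  have hbd : ∀ n, SchwartzMap.seminorm ℝ k l (u n - f) ≤ M * s n := by
    intro n
    refine SchwartzMap.seminorm_le_bound ℝ k l _ (mul_nonneg hM (hs n).le) fun x => ?_
    have hfun : ((u n - f : SchwartzMap E F) : E → F)
        = fun x => (χ (s n • x) - 1) • f x := by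
      ext x
      simp [u, sub_smul]
    rw [hfun]
    have hle := norm_iteratedFDeriv_smul_le (𝕜 := ℝ) (f := fun x => χ (s n • x) - 1) (g := f)
      (N := l) ((hsm n l).sub contDiff_const) (f.smooth l) x (n := l) le_rfl
    calc ‖x‖ ^ k * ‖iteratedFDeriv ℝ l (fun x => (χ (s n • x) - 1) • f x) x‖
        ≤ ‖x‖ ^ k * ∑ i ∈ Finset.range (l + 1), (l.choose i : ℝ) *
          ‖iteratedFDeriv ℝ i (fun x => χ (s n • x) - 1) x‖ * ‖iteratedFDeriv ℝ (l - i) f x‖ := by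
          gcongr
      _ ≤ ∑ i ∈ Finset.range (l + 1),
          (l.choose i : ℝ) * C i * SchwartzMap.seminorm ℝ (k + 1) (l - i) f * s n := by
          rw [Finset.mul_sum]
          refine Finset.sum_le_sum fun i _ => ?_
          have h1 := hC i (s n) (hs n) (hs1 n) x
          have h2 := f.le_seminorm ℝ (k + 1) (l - i) x
          have h0 := hC0 i
          have h3 := (hs n).le
          calc ‖x‖ ^ k * ((l.choose i : ℝ) *
              ‖iteratedFDeriv ℝ i (fun x => χ (s n • x) - 1) x‖ * ‖iteratedFDeriv ℝ (l - i) f x‖)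
              ≤ ‖x‖ ^ k * ((l.choose i : ℝ) *
              (C i * s n * ‖x‖) * ‖iteratedFDeriv ℝ (l - i) f x‖) := by gcongr
            _ = (l.choose i : ℝ) * C i *
              (‖x‖ ^ (k + 1) * ‖iteratedFDeriv ℝ (l - i) f x‖) * s n := by ring
            _ ≤ _ := by gcongr
      _ = M * s n := by rw [Finset.sum_mul]
  have ht : Filter.Tendsto (fun n => M * s n) Filter.atTop (nhds 0) := by
    simpa using hst.const_mul M
  filter_upwards [ht.eventually (gt_mem_nhds hε)] with n hn
  exact (hbd n).trans_lt hn

open SchwartzMap LineDeriv FourierTransform in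
/-- The operator `□ + a` on Schwartz space. -/
noncomputable def boxCLM (d : ℕ) (a : ℂ) :
    SchwartzMap (Spacetime d) ℂ →L[ℂ] SchwartzMap (Spacetime d) ℂ :=
  let D : Fin (d + 1) → (SchwartzMap (Spacetime d) ℂ →L[ℂ] SchwartzMap (Spacetime d) ℂ) :=
    fun j => lineDerivOpCLM ℂ (SchwartzMap (Spacetime d) ℂ)
      (EuclideanSpace.single j (1 : ℝ) : Spacetime d)
  D 0 ∘L D 0 - ∑ j : Fin d, D j.succ ∘L D j.succ + a • ContinuousLinearMap.id ℂ _

lemma boxCLM_apply (d : ℕ) (a : ℂ) (f : SchwartzMap (Spacetime d) ℂ) (z : Spacetime d) :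
    boxCLM d a f z = boxFun d f z + a * f z := by
  simp only [boxCLM, boxFun, _root_.add_apply, _root_.sub_apply,
    _root_.sum_apply, _root_.smul_apply, ContinuousLinearMap.id_apply,
    ContinuousLinearMap.comp_apply,
    smul_eq_mul, LineDeriv.lineDerivOpCLM_apply]
  rfl

/-- The Fourier symbol of `□ + a`. -/
noncomputable def boxSymbol (d : ℕ) (a : ℂ) (ξ : Spacetime d) : ℂ :=
  -((4 * Real.pi ^ 2 * (ξ 0 ^ 2 - ∑ j : Fin d, ξ j.succ ^ 2) : ℝ) : ℂ) + a

open SchwartzMap LineDeriv FourierTransform in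
lemma fourier_second (d : ℕ) (j : Fin (d + 1)) (f : SchwartzMap (Spacetime d) ℂ)
    (ξ : Spacetime d) :
    (𝓕 (∂_{(EuclideanSpace.single j (1 : ℝ) : Spacetime d)}
      (∂_{(EuclideanSpace.single j (1 : ℝ) : Spacetime d)} f))) ξ
      = -((4 * Real.pi ^ 2 * ξ j ^ 2 : ℝ) : ℂ) * (𝓕 f) ξ := by
  have ht : (inner ℝ · (EuclideanSpace.single j (1 : ℝ) : Spacetime d)).HasTemperateGrowth :=
    Function.hasTemperateGrowth_inner_left _
  rw [fourier_lineDerivOp_eq, fourier_lineDerivOp_eq]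
  simp only [_root_.smul_apply, smulLeftCLM_apply_apply ht, map_smul]
  simp [EuclideanSpace.inner_single_right]
  ring_nf
  simp

open SchwartzMap LineDeriv FourierTransform in
lemma fourier_boxCLM (d : ℕ) (a : ℂ) (f : SchwartzMap (Spacetime d) ℂ) (ξ : Spacetime d) :
    (𝓕 (boxCLM d a f)) ξ = boxSymbol d a ξ * (𝓕 f) ξ := by
  have h : 𝓕 (boxCLM d a f) = fourierCLM ℂ (SchwartzMap (Spacetime d) ℂ) (boxCLM d a f) := rfl
  rw [h]
  simp only [boxCLM, _root_.add_apply, _root_.sub_apply,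
    _root_.sum_apply, _root_.smul_apply, ContinuousLinearMap.id_apply,
    ContinuousLinearMap.comp_apply, map_add, map_sub, map_sum, map_smul,
   
    smul_eq_mul, LineDeriv.lineDerivOpCLM_apply,
    fourierCLM_apply, fourier_second, boxSymbol, ← Finset.sum_mul]
  push_cast
  rw [mul_sub, Finset.mul_sum, Finset.sum_neg_distrib]
  ring

open SchwartzMap LineDeriv FourierTransform in
lemma dense_main (d : ℕ) (a : ℂ) (ha : a.im ≠ 0) :
    Dense {w : Lp ℂ 2 (volume : Measure (Spacetime d)) | ∃ φ : Spacetime d → ℂ,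
        ContDiff ℝ (⊤ : ℕ∞) φ ∧ HasCompactSupport φ ∧
        ⇑w =ᵐ[volume] (fun z => boxFun d φ z + a * φ z)} := by
  let J := SchwartzMap.toLpCLM ℝ ℂ 2 (volume : Measure (Spacetime d))
  have hJ : DenseRange J := SchwartzMap.denseRange_toLpCLM (by simp)
  have hA : Dense {f : SchwartzMap (Spacetime d) ℂ | HasCompactSupport f} := dense_compactSupport
  have hcinv : Continuous fun f : SchwartzMap (Spacetime d) ℂ => 𝓕⁻ f :=
    (fourierInvCLM ℂ (SchwartzMap (Spacetime d) ℂ)).continuous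
  have hsymb : ∀ ξ, boxSymbol d a ξ ≠ 0 := by
    intro ξ h
    apply ha
    have := congrArg Complex.im h
    simpa only [boxSymbol, Complex.add_im, Complex.neg_im, Complex.ofReal_im, neg_zero, zero_add,
      Complex.zero_im] using this
  have hsm : ContDiff ℝ (⊤ : ℕ∞) (boxSymbol d a) := by
    unfold boxSymbol
    have hr : ContDiff ℝ (⊤ : ℕ∞) (fun ξ : Spacetime d =>
        4 * Real.pi ^ 2 * (ξ 0 ^ 2 - ∑ j : Fin d, ξ j.succ ^ 2)) := by
      fun_prop
    exact ContDiff.add (ContDiff.neg (Complex.ofRealCLM.contDiff.comp hr)) contDiff_const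
  have hrange : DenseRange fun f => J (boxCLM d a f) := by
    have hd1 : DenseRange fun f : SchwartzMap (Spacetime d) ℂ => J (𝓕⁻ f) :=
      hJ.comp (Function.Surjective.denseRange fun f => ⟨𝓕 f, by simp⟩) J.continuous
    refine (hd1.dense_image (J.continuous.comp hcinv) hA).mono ?_
    rintro _ ⟨g, hg, rfl⟩
    have hg' : HasCompactSupport fun ξ => (boxSymbol d a ξ)⁻¹ * g ξ :=
      HasCompactSupport.mul_left hg
    let h : SchwartzMap (Spacetime d) ℂ := hg'.toSchwartzMap ((hsm.inv hsymb).mul (g.smooth ⊤))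
    refine ⟨𝓕⁻ h, ?_⟩
    have : boxCLM d a (𝓕⁻ h) = 𝓕⁻ g := by
      have h1 : 𝓕 (boxCLM d a (𝓕⁻ h)) = g := by
        ext ξ
        rw [fourier_boxCLM, fourier_fourierInv_eq]
        change boxSymbol d a ξ * ((boxSymbol d a ξ)⁻¹ * g ξ) = g ξ
        rw [mul_inv_cancel_left₀ (hsymb ξ)]
      rw [← h1, fourierInv_fourier_eq]
    simp only [this]
  refine (hrange.dense_image (J.continuous.comp (boxCLM d a).continuous) hA).mono ?_
  rintro _ ⟨f, hf, rfl⟩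
  refine ⟨f, f.smooth ⊤, hf, ?_⟩
  filter_upwards [SchwartzMap.coeFn_toLp (boxCLM d a f) 2 volume] with z hz
  rw [← boxCLM_apply]
  exact hz

/-- **Essential self-adjointness of `□ + c` on exact Minkowski space**: for every `c ∈ ℝ`
(in particular `c = m²`), the ranges `{(□ + c + i)φ : φ ∈ C_c^∞}` and
`{(□ + c − i)φ : φ ∈ C_c^∞}` are both dense in `L²(ℝ^{1+d})`; equivalently, the closure
of `□ + c` on `C_c^∞` is self-adjoint. -/
theorem essentially_selfAdjoint_minkowski (d : ℕ) (hd : 1 ≤ d) (c : ℝ) :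
    Dense {w : Lp ℂ 2 (volume : Measure (Spacetime d)) | ∃ φ : Spacetime d → ℂ,
        ContDiff ℝ (⊤ : ℕ∞) φ ∧ HasCompactSupport φ ∧
        ⇑w =ᵐ[volume] (fun z => boxFun d φ z + ((c : ℂ) + Complex.I) * φ z)} ∧
    Dense {w : Lp ℂ 2 (volume : Measure (Spacetime d)) | ∃ φ : Spacetime d → ℂ,
        ContDiff ℝ (⊤ : ℕ∞) φ ∧ HasCompactSupport φ ∧
        ⇑w =ᵐ[volume] (fun z => boxFun d φ z + ((c : ℂ) - Complex.I) * φ z)} := by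
  exact ⟨dense_main d _ (by simp), dense_main d _ (by simp)⟩
end

section
/- Let d ≥ 1, λ ∈ ℂ with Im λ ≠ 0, U a tempered distribution on ℝ^{1+d}, and g ∈ 𝓢(ℝ^{1+d}, ℂ). Suppose that the product (4π²q + λ)·U is represented by g, i.e. U((4π²q + λ)·φ) = ∫ g·φ dζ for every φ ∈ 𝓢(ℝ^{1+d}, ℂ), where q(τ, ξ) = τ² − ‖ξ‖². Then U is represented by the Schwartz function ζ ↦ g(ζ)/(4π²q(ζ) + λ): U(φ) = ∫ g(ζ)/(4π²q(ζ) + λ)·φ(ζ) dζ for every φ ∈ 𝓢(ℝ^{1+d}, ℂ). -/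
open MeasureTheory SchwartzMap Complex Real
open scoped SchwartzMap

/-- The Minkowski quadratic form `q(ζ) = τ² − ‖ξ‖²` in the dual variables
`ζ = (τ, ξ) ∈ ℝ × ℝ^d` (coordinate `0` is `τ`). -/
noncomputable def minkQ (d : ℕ) (ζ : Spacetime d) : ℝ :=
  ζ 0 ^ 2 - ∑ j : Fin d, ζ j.succ ^ 2

theorem shift_ne (lam : ℂ) (hlam : lam.im ≠ 0) (t : ℝ) : (t : ℂ) + lam ≠ 0 := by
  intro h
  apply hlam
  simpa using congrArg Complex.im h

theorem iteratedDeriv_inv_shift (lam : ℂ) (hlam : lam.im ≠ 0) (n : ℕ) :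
    iteratedDeriv n (fun t : ℝ => ((t : ℂ) + lam)⁻¹) =
      fun t : ℝ => ((-1) ^ n * (n.factorial : ℂ)) * (((t : ℂ) + lam)⁻¹) ^ (n + 1) := by
  induction n with
  | zero => ext t; simp
  | succ n ih =>
    rw [iteratedDeriv_succ, ih]
    ext t
    have h0 : HasDerivAt (fun t : ℝ => (t : ℂ) + lam) 1 t :=
      (Complex.ofRealCLM.hasDerivAt (x := t)).add_const lam
    have h1 := (((h0.inv (shift_ne lam hlam t)).pow (n + 1)).const_mul
      ((-1) ^ n * (n.factorial : ℂ))).deriv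
    refine Eq.trans h1 ?_
    have := shift_ne lam hlam t
    simp only [Nat.factorial_succ, Pi.inv_apply]
    push_cast
    rw [neg_div, one_div, ← inv_pow]
    ring

theorem temperate_inv_shift (lam : ℂ) (hlam : lam.im ≠ 0) :
    Function.HasTemperateGrowth (fun t : ℝ => ((t : ℂ) + lam)⁻¹) := by
  refine ⟨?_, fun n => ⟨0, n.factorial * (|lam.im|⁻¹) ^ (n + 1), fun t => ?_⟩⟩
  · exact ContDiff.inv (Complex.ofRealCLM.contDiff.add contDiff_const) (shift_ne lam hlam)
  · rw [norm_iteratedFDeriv_eq_norm_iteratedDeriv, iteratedDeriv_inv_shift lam hlam]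
    simp only [norm_mul, norm_pow, norm_neg, norm_one, one_pow, one_mul, norm_inv, pow_zero,
      mul_one, Complex.norm_natCast]
    have h : |lam.im| ≤ ‖(t : ℂ) + lam‖ := by
      simpa using Complex.abs_im_le_norm ((t : ℂ) + lam)
    have h' : 0 < |lam.im| := abs_pos.mpr hlam
    gcongr

theorem temperate_minkQ (d : ℕ) :
    Function.HasTemperateGrowth (fun ζ : Spacetime d => 4 * π ^ 2 * minkQ d ζ) := by
  have hc (i : Fin (d + 1)) : Function.HasTemperateGrowth (fun ζ : Spacetime d => ζ i) :=
    (EuclideanSpace.proj (𝕜 := ℝ) i : Spacetime d →L[ℝ] ℝ).hasTemperateGrowth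
  unfold minkQ
  exact (Function.HasTemperateGrowth.const _).mul
    (((hc 0).pow 2).sub (Function.HasTemperateGrowth.sum fun j _ => (hc j.succ).pow 2))

/-- If a tempered distribution `U` is such that `(4π²q + λ)·U` is represented by a
Schwartz function `g` (i.e. `U((4π²q + λ)·φ) = ∫ g·φ` for all Schwartz `φ`), with
`Im λ ≠ 0`, then `U` itself is represented by the Schwartz function
`ζ ↦ g(ζ)/(4π²q(ζ) + λ)`. -/
theorem divide_distribution_by_symbol (d : ℕ) (hd : 1 ≤ d)
    (lam : ℂ) (hlam : lam.im ≠ 0)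
    (U : 𝓢(Spacetime d, ℂ) →L[ℂ] ℂ) (g : 𝓢(Spacetime d, ℂ))
    (hU : ∀ φ ψ : 𝓢(Spacetime d, ℂ),
      (∀ ζ : Spacetime d, ψ ζ = (((4 * π ^ 2 * minkQ d ζ : ℝ) : ℂ) + lam) * φ ζ) →
      U ψ = ∫ ζ, g ζ * φ ζ) :
    ∃ h : 𝓢(Spacetime d, ℂ),
      (∀ ζ : Spacetime d, h ζ = g ζ / (((4 * π ^ 2 * minkQ d ζ : ℝ) : ℂ) + lam)) ∧
      ∀ φ : 𝓢(Spacetime d, ℂ), U φ = ∫ ζ, h ζ * φ ζ := by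
  have hT : Function.HasTemperateGrowth
      (fun ζ : Spacetime d => (((4 * π ^ 2 * minkQ d ζ : ℝ) : ℂ) + lam)⁻¹) :=
    (temperate_inv_shift lam hlam).comp (temperate_minkQ d)
  refine ⟨SchwartzMap.smulLeftCLM ℂ
    (fun ζ : Spacetime d => (((4 * π ^ 2 * minkQ d ζ : ℝ) : ℂ) + lam)⁻¹) g, fun ζ => ?_, fun φ => ?_⟩
  · rw [SchwartzMap.smulLeftCLM_apply_apply hT, smul_eq_mul, div_eq_mul_inv, mul_comm]
  · rw [hU (SchwartzMap.smulLeftCLM ℂ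
      (fun ζ : Spacetime d => (((4 * π ^ 2 * minkQ d ζ : ℝ) : ℂ) + lam)⁻¹) φ) φ]
    · congr 1
      ext ζ
      rw [SchwartzMap.smulLeftCLM_apply_apply hT, SchwartzMap.smulLeftCLM_apply_apply hT]
      simp only [smul_eq_mul]
      ring
    · intro ζ
      rw [SchwartzMap.smulLeftCLM_apply_apply hT, smul_eq_mul,
        mul_inv_cancel_left₀ (shift_ne lam hlam _)]
end
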